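/- arXiv:2211.12367 — 3 statements merged into one kernel-verified Lean document; each statement's English description precedes it below -/
import Mathlib

section
/- Let g = hr be odd and suppose there exists a cyclic skew frame starter of type h^r in Z_g. Then ∑_{j ∈ half(G,H)} j^2 ≡ 0 (mod g), where half(G,H) = {j : 1 ≤ j ≤ (g−1)/2, j ≢ 0 (mod r)}. -/
/-- The family `f`, indexed by `Fin m ⊕ Fin m`, hits each element of `G \\ H`
exactly once. -/
def CoversComplement {G : Type*} [AddCommGroup G] (H : AddSubgroup G) {m : ℕ}
    (f : Fin m ⊕ Fin m → G) : Prop :=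
  Function.Injective f ∧ Set.range f = {z : G | z ∉ H}

/-- The pairs `{x i, y i}` form a frame starter in `G \\ H`: the entries hit each
element of `G \\ H` exactly once, and so do the differences `±(x i - y i)`. -/
def IsFrameStarter {G : Type*} [AddCommGroup G] (H : AddSubgroup G) {m : ℕ}
    (x y : Fin m → G) : Prop :=
  CoversComplement H (Sum.elim x y) ∧
    CoversComplement H (Sum.elim (fun i => x i - y i) (fun i => y i - x i))

/-- A frame starter is strong if the sums `x i + y i` avoid `H` and are pairwise
distinct. -/
def IsStrongFS {G : Type*} [AddCommGroup G] (H : AddSubgroup G) {m : ℕ}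
    (x y : Fin m → G) : Prop :=
  (∀ i, x i + y i ∉ H) ∧ Function.Injective fun i => x i + y i

/-- A frame starter is skew if the sums `±(x i + y i)` hit each element of
`G \\ H` exactly once. -/
def IsSkewFS {G : Type*} [AddCommGroup G] (H : AddSubgroup G) {m : ℕ}
    (x y : Fin m → G) : Prop :=
  CoversComplement H (Sum.elim (fun i => x i + y i) (fun i => -(x i + y i)))

/-- Summing `F` along a family that covers `G \\ H` gives the sum of `F` over `G \\ H`. -/
theorem CoversComplement.sum_comp {G M : Type*} [AddCommGroup G] [Fintype G] [AddCommMonoid M]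
    {H : AddSubgroup G} [DecidablePred (· ∈ H)] {m : ℕ} {f : Fin m ⊕ Fin m → G}
    (hf : CoversComplement H f) (F : G → M) :
    ∑ i, F (f i) = ∑ z, if z ∈ H then 0 else F z := by
  have hmem (z : G) : z ∉ H ↔ ∃ i, f i = z :=
    (Set.ext_iff.mp hf.2 z).symm
  classical
  rw [← Finset.sum_image (f := F) hf.1.injOn]
  simp_rw [← ite_not (_ ∈ H)]
  rw [← Finset.sum_filter]
  refine Finset.sum_congr ?_ fun _ _ => rfl
  ext z
  simp [hmem]

theorem natCast_mem_zmultiples_iff_dvd {g r : ℕ} (hrg : r ∣ g) (a : ℕ) :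
    (a : ZMod g) ∈ AddSubgroup.zmultiples (r : ZMod g) ↔ r ∣ a := by
  rw [AddSubgroup.mem_zmultiples_iff]
  constructor
  · rintro ⟨n, hn⟩
    have hcast : ((n * r : ℤ) : ZMod g) = ((a : ℤ) : ZMod g) := by
      simpa using hn
    rw [ZMod.intCast_eq_intCast_iff_dvd_sub] at hcast
    have hdvd : (r : ℤ) ∣ a - n * r := (Int.natCast_dvd_natCast.mpr hrg).trans hcast
    exact Int.natCast_dvd_natCast.mp ((dvd_sub_left (Dvd.intro_left n rfl)).mp hdvd)
  · rintro ⟨c, rfl⟩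
    exact ⟨c, by simp [mul_comm]⟩

/-- For odd modulus, the squares over the complement of `⟨r⟩` sum to twice the sum over the
representatives in the lower half. -/
theorem sum_sq_compl_zmultiples {k r : ℕ} (hr : r ∣ 2 * k + 1)
    [DecidablePred (· ∈ AddSubgroup.zmultiples (r : ZMod (2 * k + 1)))] :
    (∑ z : ZMod (2 * k + 1),
        if z ∈ AddSubgroup.zmultiples (r : ZMod (2 * k + 1)) then 0 else z ^ 2) =
      2 * ∑ j ∈ (Finset.Icc 1 k).filter (fun j => ¬ r ∣ j), (j : ZMod (2 * k + 1)) ^ 2 := by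
  let F : ℕ → ZMod (2 * k + 1) := fun j => if r ∣ j then 0 else (j : ZMod (2 * k + 1)) ^ 2
  have hF (z : ZMod (2 * k + 1)) :
      (if z ∈ AddSubgroup.zmultiples (r : ZMod (2 * k + 1)) then 0 else z ^ 2) = F z.val := by
    have h := natCast_mem_zmultiples_iff_dvd hr z.val
    rw [ZMod.natCast_zmod_val] at h
    simp only [F, h, ZMod.natCast_zmod_val]
  have hrange : ∑ z : ZMod (2 * k + 1), F z.val = ∑ j ∈ Finset.range (2 * k + 1), F j :=
    Fin.sum_univ_eq_sum_range F (2 * k + 1)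
  have hreflect (j : ℕ) (hj : j < k) : F (k + (k - 1 - j) + 1) = F (j + 1) := by
    have hsum : (k + (k - 1 - j) + 1) + (j + 1) = 2 * k + 1 := by omega
    have hdvd : r ∣ k + (k - 1 - j) + 1 ↔ r ∣ j + 1 := by
      rw [← hsum] at hr
      exact ⟨fun h => (Nat.dvd_add_right h).mp hr, fun h => (Nat.dvd_add_left h).mp hr⟩
    have hneg : ((k + (k - 1 - j) + 1 : ℕ) : ZMod (2 * k + 1)) = -((j + 1 : ℕ)) := by
      rw [eq_neg_iff_add_eq_zero, ← Nat.cast_add, hsum, ZMod.natCast_self]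
    simp only [F, hdvd, hneg, neg_sq]
  have hhalf : ∑ j ∈ (Finset.Icc 1 k).filter (fun j => ¬ r ∣ j), (j : ZMod (2 * k + 1)) ^ 2 =
      ∑ j ∈ Finset.range k, F (j + 1) := by
    rw [Finset.sum_filter, Finset.range_eq_Ico, Finset.sum_Ico_add' F 0 k 1]
    refine Finset.sum_congr (by ext; simp) fun j _ => ?_
    simp only [F, ite_not]
  have hzero : F 0 = 0 := by simp [F]
  have hsplit : ∑ j ∈ Finset.range (2 * k), F (j + 1) =
      ∑ j ∈ Finset.range k, F (j + 1) + ∑ j ∈ Finset.range k, F (k + j + 1) :=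
    (congrArg (fun n => ∑ j ∈ Finset.range n, F (j + 1)) (two_mul k)).trans
      (Finset.sum_range_add _ k k)
  rw [Finset.sum_congr rfl fun z _ => hF z, hrange, hhalf, Finset.sum_range_succ', hzero, add_zero,
    hsplit, two_mul (∑ j ∈ Finset.range k, F (j + 1)),
    ← Finset.sum_range_reflect (fun j => F (k + j + 1))]
  congr 1
  exact Finset.sum_congr rfl fun j hj => hreflect j (Finset.mem_range.mp hj)

/-- If `g = h * r` is odd and there is a cyclic skew frame starter of
type `h^r` in `ℤ_g`, then `∑_{j ∈ half(G,H)} j^2 ≡ 0 (mod g)`, where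
`half(G,H) = {j : 1 ≤ j ≤ (g-1)/2, r ∤ j}`. -/
theorem stmt6 (g h r : ℕ) (hg : g = h * r) (hodd : Odd g)
    (hex : ∃ (m : ℕ) (x y : Fin m → ZMod g),
      IsFrameStarter (AddSubgroup.zmultiples (r : ZMod g)) x y ∧
        IsSkewFS (AddSubgroup.zmultiples (r : ZMod g)) x y) :
    (g : ℤ) ∣ ∑ j ∈ (Finset.Icc 1 ((g - 1) / 2)).filter (fun j => ¬ r ∣ j),
      (j : ℤ) ^ 2 := by
  classical
  obtain ⟨m, x, y, ⟨hxy, hdiff⟩, hskew⟩ := hex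
  obtain ⟨k, rfl⟩ := hodd
  have hr : r ∣ 2 * k + 1 := ⟨h, by rw [hg, mul_comm]⟩
  have hA := sum_sq_compl_zmultiples hr
  have hentries := hxy.sum_comp (· ^ 2)
  have hdiffs := hdiff.sum_comp (· ^ 2)
  have hsums := hskew.sum_comp (· ^ 2)
  rw [hA] at hentries hdiffs hsums
  simp only [Fintype.sum_sum_type, Sum.elim_inl, Sum.elim_inr, ← Finset.sum_add_distrib]
    at hentries hdiffs hsums
  set T := ∑ j ∈ (Finset.Icc 1 k).filter (fun j => ¬ r ∣ j), (j : ZMod (2 * k + 1)) ^ 2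
  have hpar : 2 * T + 2 * T = 4 * (2 * T) := by
    refine (congrArg₂ (· + ·) hsums hdiffs).symm.trans ?_
    rw [← hentries, ← Finset.sum_add_distrib, Finset.mul_sum]
    exact Finset.sum_congr rfl fun i _ => by ring
  have htwo : IsUnit (2 : ZMod (2 * k + 1)) := by
    exact_mod_cast (ZMod.isUnit_iff_coprime 2 (2 * k + 1)).mpr (by simp)
  have hT : T = 0 := by
    refine (htwo.mul htwo).mul_right_eq_zero.mp ?_
    linear_combination -hpar
  rw [← ZMod.intCast_zmod_eq_zero_iff_dvd, show (2 * k + 1 - 1) / 2 = k by omega]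
  push_cast
  exact hT
end

section
/- If t is an odd positive integer, then there does not exist a skew starter in Z_{3t}. -/
/-- A function summed along a family covering the nonzero elements of a finite group, plus its
value at zero, is its sum over the group. -/
theorem CoversComplement.sum_add_apply_zero {G M : Type*} [AddCommGroup G] [Fintype G]
    [AddCommMonoid M] {m : ℕ} {f : Fin m ⊕ Fin m → G}
    (hf : CoversComplement (⊥ : AddSubgroup G) f) (g : G → M) :
    (∑ i, g (f i)) + g 0 = ∑ z, g z := by
  classical
  have himage : Finset.univ.image f = Finset.univ.erase (0 : G) := by
    ext z
    have hz : z ∈ Set.range f ↔ z ∉ (⊥ : AddSubgroup G) := by rw [hf.2]; rfl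
    simpa using hz
  rw [← Finset.sum_erase_add _ _ (Finset.mem_univ (0 : G)), ← himage,
    Finset.sum_image fun a _ b _ h => hf.1 h]

theorem ZMod.sum_range_natCast {M : Type*} [AddCommMonoid M] (n : ℕ) [NeZero n]
    (g : ZMod n → M) : ∑ i ∈ Finset.range n, g i = ∑ z, g z := by
  refine Finset.sum_bij' (fun i _ => (i : ZMod n)) (fun z _ => z.val) ?_ ?_ ?_ ?_ ?_
  · simp
  · intro z _
    simpa using z.val_lt
  · intro i hi
    exact ZMod.val_cast_of_lt (Finset.mem_range.1 hi)
  · simp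
  · simp

theorem six_mul_sum_range_sq (n : ℕ) :
    6 * ∑ i ∈ Finset.range n, (i : ℤ) ^ 2 = (n - 1) * n * (2 * n - 1) := by
  induction n with
  | zero => simp
  | succ k ih =>
    rw [Finset.sum_range_succ, mul_add, ih]
    push_cast
    ring

/-- In a finite commutative ring whose additive group has a skew starter, twice the sum of all
squares vanishes. -/
theorem two_mul_sum_sq_eq_zero_of_isSkewFS {R : Type*} [CommRing R] [Fintype R] {m : ℕ}
    {x y : Fin m → R} (hstarter : IsFrameStarter (⊥ : AddSubgroup R) x y)
    (hskew : IsSkewFS (⊥ : AddSubgroup R) x y) : 2 * ∑ z : R, z ^ 2 = 0 := by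
  have hentries := hstarter.1.sum_add_apply_zero (fun z => z ^ 2)
  have hdiffs := hstarter.2.sum_add_apply_zero (fun z => z ^ 2)
  have hsums := CoversComplement.sum_add_apply_zero hskew (fun z => z ^ 2)
  simp only [Fintype.sum_sum_type, Sum.elim_inl, Sum.elim_inr, ← Finset.sum_add_distrib,
    ne_eq, OfNat.ofNat_ne_zero, not_false_eq_true, zero_pow, add_zero] at hentries hdiffs hsums
  have hparallelogram : ∑ i, ((x i - y i) ^ 2 + (y i - x i) ^ 2) +
      ∑ i, ((x i + y i) ^ 2 + (-(x i + y i)) ^ 2) = 4 * ∑ i, (x i ^ 2 + y i ^ 2) := by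
    rw [← Finset.sum_add_distrib, Finset.mul_sum]
    exact Finset.sum_congr rfl fun i _ => by ring
  rw [hentries, hdiffs, hsums] at hparallelogram
  linear_combination -hparallelogram

/-- If `t` is an odd positive integer, then there is no skew starter
in `ℤ_{3t}`. -/
theorem stmt9 (t : ℕ) (ht : 0 < t) (hodd : Odd t) :
    ¬ ∃ (m : ℕ) (x y : Fin m → ZMod (3 * t)),
      IsFrameStarter (⊥ : AddSubgroup (ZMod (3 * t))) x y ∧
        IsSkewFS (⊥ : AddSubgroup (ZMod (3 * t))) x y := by
  rintro ⟨m, x, y, hstarter, hskew⟩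
  have : NeZero (3 * t) := ⟨by omega⟩
  have hzero := two_mul_sum_sq_eq_zero_of_isSkewFS hstarter hskew
  rw [← ZMod.sum_range_natCast (3 * t) fun z => z ^ 2] at hzero
  have hdvd : ((3 * t : ℕ) : ℤ) ∣ 2 * ∑ i ∈ Finset.range (3 * t), (i : ℤ) ^ 2 := by
    rw [← ZMod.intCast_zmod_eq_zero_iff_dvd]
    push_cast
    exact hzero
  obtain ⟨c, hc⟩ := hdvd
  have hsum := six_mul_sum_range_sq (3 * t)
  push_cast at hc hsum
  have ht' : (t : ℤ) ≠ 0 := by exact_mod_cast ht.ne'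
  have hcancel : 3 * c = (3 * t - 1) * (6 * t - 1) := by
    apply mul_left_cancel₀ (mul_ne_zero three_ne_zero ht')
    linear_combination hsum - 3 * hc
  have : 3 * (c - 6 * t ^ 2 + 3 * t) = 1 := by linear_combination hcancel
  omega
end

section
/- Let h and t be positive integers with ht ≢ 0 (mod 4). Then there does not exist a cyclic skew frame starter of type h^{4t} in Z_{4ht}. -/
/-- The square of a residue modulo `8`, which is well defined modulo `16`. -/
def sqLift (a : ZMod 8) : ZMod 16 := (a.val : ZMod 16) ^ 2

theorem sqLift_neg : ∀ a : ZMod 8, sqLift (-a) = sqLift a := by decide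

theorem sqLift_add_add_sqLift_sub : ∀ a b : ZMod 8,
    sqLift (a + b) + sqLift (a - b) = 2 * (sqLift a + sqLift b) := by decide

theorem sqLift_mul_four : ∀ a : ZMod 8, sqLift (a * 4) = 0 := by decide

theorem sum_range_sqLift (k : ℕ) :
    ∑ i ∈ Finset.range (8 * k), sqLift (i : ZMod 8) = 12 * (k : ZMod 16) := by
  induction k with
  | zero => simp
  | succ k ih =>
    have h8 : (8 : ZMod 8) = 0 := by decide
    have hsum : ∑ i ∈ Finset.range 8, sqLift (i : ZMod 8) = 12 := by decide
    rw [Nat.mul_succ, Finset.sum_range_add, ih]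
    push_cast
    simp only [h8, zero_mul, zero_add, hsum]
    ring

theorem ZMod.sum_eq_sum_range {M : Type*} [AddCommMonoid M] (n : ℕ) [NeZero n]
    (f : ZMod n → M) : ∑ z, f z = ∑ i ∈ Finset.range n, f (i : ZMod n) := by
  refine Finset.sum_nbij' ZMod.val (fun i : ℕ => (i : ZMod n)) ?_ ?_ ?_ ?_ ?_
  · intro z _
    simpa using ZMod.val_lt z
  · simp
  · simp
  · intro i hi
    exact ZMod.val_cast_of_lt (Finset.mem_range.mp hi)
  · simp

theorem CoversComplement.sum_eq {G M : Type*} [AddCommGroup G] [Fintype G] [AddCommMonoid M]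
    {H : AddSubgroup G} {m : ℕ} {f : Fin m ⊕ Fin m → G} (hf : CoversComplement H f)
    (q : G → M) (hq : ∀ z ∈ H, q z = 0) : ∑ s, q (f s) = ∑ z, q z := by
  refine Fintype.sum_of_injective f hf.1 _ _ (fun z hz => hq z ?_) (fun _ => rfl)
  rw [hf.2] at hz
  simpa using hz

/-- If each element outside `H` occurs exactly once among `±d i`, then `H` contains every
element that is its own negative. -/
theorem CoversComplement.mem_of_neg_eq {G : Type*} [AddCommGroup G] {H : AddSubgroup G} {m : ℕ}
    {d : Fin m → G} (hd : CoversComplement H (Sum.elim d fun i => -d i)) {z : G}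
    (hz : -z = z) : z ∈ H := by
  by_contra hzH
  have hz' : z ∈ Set.range (Sum.elim d fun i => -d i) := by
    rw [hd.2]
    exact hzH
  have key : ∀ i, -d i ≠ d i := fun i hi => by
    simpa using @hd.1 (Sum.inr i) (Sum.inl i) hi
  obtain ⟨i | i, rfl⟩ := hz'
  · exact key i hz
  · exact key i (by simpa using hz.symm)

/-- An even function satisfying the parallelogram law and vanishing on `H` has a total sum
killed by `2`, as soon as there is a skew frame starter in `G \\ H`. -/
theorem IsSkewFS.two_mul_sum_eq_zero {G R : Type*} [AddCommGroup G] [Fintype G] [CommRing R]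
    {H : AddSubgroup G} {m : ℕ} {x y : Fin m → G} (hS : IsFrameStarter H x y)
    (hskew : IsSkewFS H x y) (q : G → R) (hneg : ∀ z, q (-z) = q z)
    (hpar : ∀ a b, q (a + b) + q (a - b) = 2 * (q a + q b)) (hq : ∀ z ∈ H, q z = 0) :
    2 * ∑ z, q z = 0 := by
  have hE := hS.1.sum_eq q hq
  have hD := hS.2.sum_eq q hq
  have hP := hskew.sum_eq q hq
  have hsub : ∀ i, q (y i - x i) = q (x i - y i) := fun i => by rw [← hneg, neg_sub]
  simp only [Fintype.sum_sum_type, Sum.elim_inl, Sum.elim_inr, hneg, hsub] at hE hD hP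
  have hsum : ∑ i, q (x i + y i) + ∑ i, q (x i - y i) = 2 * (∑ i, q (x i) + ∑ i, q (y i)) := by
    rw [← Finset.sum_add_distrib, ← Finset.sum_add_distrib, Finset.mul_sum]
    exact Finset.sum_congr rfl fun i _ => hpar _ _
  linear_combination hD + hP - 2 * hsum - 4 * hE

/-- If `h * t ≢ 0 (mod 4)`, then there is no cyclic skew frame
starter of type `h^(4t)` in `ℤ_{4ht}` (with `H` the subgroup of order `h`,
generated by `4t`). -/
theorem stmt15 (h t : ℕ) (hh : 0 < h) (ht : 0 < t) (hmod : ¬ 4 ∣ h * t) :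
    ¬ ∃ (m : ℕ) (x y : Fin m → ZMod (4 * h * t)),
      IsFrameStarter (AddSubgroup.zmultiples ((4 * t : ℕ) : ZMod (4 * h * t))) x y ∧
        IsSkewFS (AddSubgroup.zmultiples ((4 * t : ℕ) : ZMod (4 * h * t))) x y := by
  rintro ⟨m, x, y, hS, hskew⟩
  have h_even : Even h := by
    have hmem := hskew.mem_of_neg_eq (z := ((2 * h * t : ℕ) : ZMod (4 * h * t))) (by
      rw [neg_eq_iff_add_eq_zero, ← Nat.cast_add, ZMod.natCast_eq_zero_iff]
      exact ⟨1, by ring⟩)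
    obtain ⟨n, hn⟩ := AddSubgroup.mem_zmultiples_iff.mp hmem
    have hn' : ((n * (4 * t) : ℤ) : ZMod (4 * h * t)) = ((2 * h * t : ℤ) : ZMod (4 * h * t)) := by
      simpa using hn
    obtain ⟨c, hc⟩ := (ZMod.intCast_eq_intCast_iff_dvd_sub _ _ _).mp hn'
    have ht' : (2 * t : ℤ) ≠ 0 := by positivity
    have hc' : (h : ℤ) = 2 * (n + h * c) := by
      apply mul_left_cancel₀ ht'
      push_cast at hc
      linear_combination hc
    exact (Int.even_coe_nat h).mp (even_iff_two_dvd.mpr ⟨_, hc'⟩)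
  obtain ⟨a, rfl⟩ := h_even.two_dvd
  have hk : Odd (a * t) := by
    rw [← Nat.not_even_iff_odd]
    rintro ⟨b, hb⟩
    exact hmod ⟨b, by linear_combination 2 * hb⟩
  have hg : 4 * (2 * a) * t = 8 * (a * t) := by ring
  have : NeZero (4 * (2 * a) * t) := ⟨by positivity⟩
  let φ := ZMod.castHom (Dvd.intro _ hg.symm : 8 ∣ 4 * (2 * a) * t) (ZMod 8)
  have hzero := hskew.two_mul_sum_eq_zero hS (fun z => sqLift (φ z))
    (fun z => by rw [map_neg, sqLift_neg])
    (fun z w => by rw [map_add, map_sub, sqLift_add_add_sqLift_sub])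
    (fun z hz => by
      obtain ⟨n, rfl⟩ := AddSubgroup.mem_zmultiples_iff.mp hz
      rw [map_zsmul, map_natCast, zsmul_eq_mul, Nat.cast_mul, mul_comm ((4 : ℕ) : ZMod 8),
        ← mul_assoc]
      exact sqLift_mul_four _)
  rw [ZMod.sum_eq_sum_range] at hzero
  simp only [map_natCast] at hzero
  rw [hg, sum_range_sqLift] at hzero
  obtain ⟨b, hb⟩ := hk
  have hcast : ((2 * (12 * (2 * b + 1)) : ℕ) : ZMod 16) = 0 := by
    rw [hb] at hzero
    exact_mod_cast hzero
  rw [ZMod.natCast_eq_zero_iff] at hcast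
  omega
end
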